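/- arXiv:2406.07166 — 2 statements merged into one kernel-verified Lean document; each statement's English description precedes it below -/
import Mathlib

section
/- Let A be a set of pseudoultrametric-preserving functions ℝ≥0 → ℝ≥0 that contains the identity map and is closed under composition (i.e., A is a submonoid of the monoid of pseudoultrametric-preserving functions under composition). Define X := { g ∘ d⁺ : g ∈ A }, a set of pseudoultrametrics on ℝ≥0, where d⁺(p,q) = 0 if p = q and d⁺(p,q) = max(p,q) otherwise. Then P_X = A, where P_X is the set of all functions f : ℝ≥0 → ℝ≥0 such that f ∘ ρ ∈ X for every ρ ∈ X. -/
open NNReal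

universe u

/-- `d : Y → Y → ℝ≥0` is a pseudoultrametric on `Y`. -/
def IsPseudoUltrametric {Y : Type u} (d : Y → Y → ℝ≥0) : Prop :=
  (∀ x, d x x = 0) ∧
  (∀ x y, d x y = d y x) ∧
  (∀ x y z, d x y ≤ max (d x z) (d z y))

/-- `f : ℝ≥0 → ℝ≥0` is pseudoultrametric-preserving. -/
def PseudoUltrametricPreserving (f : ℝ≥0 → ℝ≥0) : Prop :=
  ∀ (Y : Type u) (d : Y → Y → ℝ≥0), IsPseudoUltrametric d →
    IsPseudoUltrametric (fun x y => f (d x y))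

/-- The ultrametric `d⁺` on `ℝ≥0`. -/
noncomputable def dPlus (p q : ℝ≥0) : ℝ≥0 := if p = q then 0 else max p q

/-- For a set `X` of pseudoultrametrics on `ℝ≥0`, `PX X` is the set of all
functions `f : ℝ≥0 → ℝ≥0` with `f ∘ ρ ∈ X` for every `ρ ∈ X`. -/
def PX (X : Set (ℝ≥0 → ℝ≥0 → ℝ≥0)) : Set (ℝ≥0 → ℝ≥0) :=
  {f | ∀ ρ ∈ X, (fun p q => f (ρ p q)) ∈ X}

theorem dPlus_zero_left (t : ℝ≥0) : dPlus 0 t = t := by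
  by_cases h : 0 = t <;> simp [dPlus, h]

/-- if `A` is a submonoid of the pseudoultrametric-preserving
functions and `X = {g ∘ d⁺ : g ∈ A}`, then `P_X = A`. -/
theorem PX_of_orbit_eq (A : Set (ℝ≥0 → ℝ≥0))
    (hA : ∀ f ∈ A, PseudoUltrametricPreserving.{u} f)
    (hid : (id : ℝ≥0 → ℝ≥0) ∈ A)
    (hcomp : ∀ f ∈ A, ∀ g ∈ A, f ∘ g ∈ A) :
    PX {ρ | ∃ g ∈ A, ρ = fun p q => g (dPlus p q)} = A := by
  ext f
  constructor
  · intro hf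
    obtain ⟨g, hg, h⟩ := hf dPlus ⟨id, hid, rfl⟩
    have hfg : f = g := by
      funext t
      simpa only [dPlus_zero_left] using congrFun (congrFun h 0) t
    exact hfg ▸ hg
  · rintro hf ρ ⟨g, hg, rfl⟩
    exact ⟨f ∘ g, hcomp f hf g hg, rfl⟩
end

section
/- Let A be a nonempty set of pseudoultrametric-preserving functions ℝ≥0 → ℝ≥0. Then A contains the identity map and is closed under composition (i.e., A is a submonoid of the monoid of pseudoultrametric-preserving functions under composition) if and only if there exists a nonempty set X of pseudoultrametrics on ℝ≥0 such that P_X = A, where P_X is the set of all functions f : ℝ≥0 → ℝ≥0 such that f ∘ ρ ∈ X for every ρ ∈ X. -/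
open NNReal

universe u

/-- The ultrametric on `ℝ≥0` whose value at distinct points is their maximum. -/
noncomputable def maxUltrametric (p q : ℝ≥0) : ℝ≥0 := if p = q then 0 else max p q

theorem isPseudoUltrametric_maxUltrametric : IsPseudoUltrametric maxUltrametric := by
  refine ⟨fun x => by simp [maxUltrametric], fun x y => ?_, fun x y z => ?_⟩
  · simp only [maxUltrametric, eq_comm (a := x), max_comm x]
  · unfold maxUltrametric
    rcases le_total x y with h | h <;> split_ifs <;> simp_all

@[simp]
theorem maxUltrametric_zero_left (t : ℝ≥0) : maxUltrametric 0 t = t := by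
  unfold maxUltrametric
  split_ifs with h <;> simp [h]

/-- Preservation of pseudoultrametrics on sets in a universe `u` implies preservation on sets in
the lowest universe. -/
theorem PseudoUltrametricPreserving.comp_isPseudoUltrametric {f : ℝ≥0 → ℝ≥0}
    (hf : PseudoUltrametricPreserving.{u} f) {Y : Type} {d : Y → Y → ℝ≥0}
    (hd : IsPseudoUltrametric d) : IsPseudoUltrametric (fun x y => f (d x y)) := by
  obtain ⟨h₁, h₂, h₃⟩ := hf (ULift.{u} Y) (fun x y => d x.down y.down)
    ⟨fun _ => hd.1 _, fun _ _ => hd.2.1 _ _, fun _ _ _ => hd.2.2 _ _ _⟩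
  exact ⟨fun x => h₁ ⟨x⟩, fun x y => h₂ ⟨x⟩ ⟨y⟩, fun x y z => h₃ ⟨x⟩ ⟨y⟩ ⟨z⟩⟩

/-- a nonempty set `A` of pseudoultrametric-preserving functions is
a submonoid (contains the identity and is closed under composition) iff there is
a nonempty set `X` of pseudoultrametrics on `ℝ≥0` with `P_X = A`. -/
theorem submonoid_iff_exists_PX (A : Set (ℝ≥0 → ℝ≥0)) (hne : A.Nonempty)
    (hA : ∀ f ∈ A, PseudoUltrametricPreserving.{u} f) :
    ((id : ℝ≥0 → ℝ≥0) ∈ A ∧ ∀ f ∈ A, ∀ g ∈ A, f ∘ g ∈ A) ↔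
      ∃ X : Set (ℝ≥0 → ℝ≥0 → ℝ≥0), X.Nonempty ∧
        (∀ ρ ∈ X, IsPseudoUltrametric ρ) ∧ PX X = A := by
  constructor
  · rintro ⟨hid, hcomp⟩
    refine ⟨Set.image (fun f p q => f (maxUltrametric p q)) A, hne.image _, ?_, ?_⟩
    · rintro _ ⟨f, hf, rfl⟩
      exact (hA f hf).comp_isPseudoUltrametric isPseudoUltrametric_maxUltrametric
    · ext f
      constructor
      · intro hf
        obtain ⟨g, hg, hgf⟩ := hf _ ⟨id, hid, rfl⟩
        have h : g = f := funext fun t => by simpa using congrFun₂ hgf 0 t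
        exact h ▸ hg
      · rintro hf _ ⟨g, hg, rfl⟩
        exact ⟨f ∘ g, hcomp f hf g hg, rfl⟩
  · rintro ⟨X, -, -, rfl⟩
    exact ⟨fun ρ hρ => hρ, fun f hf g hg ρ hρ => hf _ (hg ρ hρ)⟩
end
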